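/- (Pfaff-type recurrence for the q-Dixon sum) Let q be a nonzero complex number, let n ≥ 1 be an integer, and let s, b be nonzero complex numbers (write a = s²) such that (q;q)_n ≠ 0, (−s;q)_{n+1} ≠ 0, (s²q/b;q)_{n+1} ≠ 0, (s²q^{n−1};q)_{n+2} ≠ 0, and b ≠ s²q. Define S_n(s,b;q) := ∑_{j=0}^{n} ((s²;q)_j (−qs;q)_j (b;q)_j (q^{-n};q)_j / ((q;q)_j (−s;q)_j (s²q/b;q)_j (s²q^{n+1};q)_j)) (q^{n+1} s/b)^j. Then S_n(s,b;q) − S_{n−1}(s,b;q) = − ((1−s)(1+qs)(1−s²q)(1−b)(q^n s/b) / ((1−s²q/b)(1−s²q^n)(1−s²q^{n+1}))) · S_{n−1}(sq, bq; q), where S_{n−1}(sq,bq;q) is the same sum with s replaced by sq, b replaced by bq, and n replaced by n−1 (i.e. the parameter a = s² is replaced by aq² and b by bq). -/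

import Mathlib

/-- The $q$-shifted factorial $(a;q)_m = \prod_{k=0}^{m-1}(1 - a q^k)$. -/
noncomputable def qPoch (q a : ℂ) (m : ℕ) : ℂ := ∏ k ∈ Finset.range m, (1 - a * q ^ k)

/-- The terminating $q$-Dixon sum (with $a = s^2$)
$S_n(s,b;q) = \sum_{j=0}^n \frac{(s^2;q)_j (-qs;q)_j (b;q)_j (q^{-n};q)_j}
{(q;q)_j (-s;q)_j (s^2 q/b;q)_j (s^2 q^{n+1};q)_j} (q^{n+1} s/b)^j$. -/
noncomputable def Sdix (q s b : ℂ) (n : ℕ) : ℂ :=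
  ∑ j ∈ Finset.range (n + 1),
    qPoch q (s ^ 2) j * qPoch q (-(q * s)) j * qPoch q b j * qPoch q (q ^ (-(n : ℤ))) j /
      (qPoch q q j * qPoch q (-s) j * qPoch q (s ^ 2 * q / b) j *
        qPoch q (s ^ 2 * q ^ (n + 1)) j) * (q ^ (n + 1) * s / b) ^ j

theorem qPoch_succ (q a : ℂ) (m : ℕ) :
    qPoch q a (m + 1) = qPoch q a m * (1 - a * q ^ m) :=
  Finset.prod_range_succ _ _

theorem qPoch_succ_left (q a : ℂ) (m : ℕ) :
    qPoch q a (m + 1) = (1 - a) * qPoch q (a * q) m := by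
  unfold qPoch
  rw [Finset.prod_range_succ', mul_comm]
  congr 1
  · simp
  · exact Finset.prod_congr rfl fun k _ => by ring

theorem one_sub_mul_pow_ne_zero_of_qPoch_ne_zero {q a : ℂ} {m k : ℕ}
    (h : qPoch q a m ≠ 0) (hk : k < m) : 1 - a * q ^ k ≠ 0 :=
  Finset.prod_ne_zero_iff.mp h k (Finset.mem_range.mpr hk)

theorem qPoch_ne_zero_of_le {q a : ℂ} {m k : ℕ} (h : qPoch q a m ≠ 0) (hk : k ≤ m) :
    qPoch q a k ≠ 0 :=
  Finset.prod_ne_zero_iff.mpr fun _ hi =>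
    one_sub_mul_pow_ne_zero_of_qPoch_ne_zero h ((Finset.mem_range.mp hi).trans_le hk)

/-- The shifted factorial of a shifted argument, when it sits inside a nonvanishing one. -/
theorem qPoch_shift_ne_zero {q a c : ℂ} {m k l : ℕ} (h : qPoch q a m ≠ 0)
    (hc : c = a * q ^ l) (hk : l + k ≤ m) : qPoch q c k ≠ 0 := by
  refine Finset.prod_ne_zero_iff.mpr fun i hi => ?_
  have hi := Finset.mem_range.mp hi
  have := one_sub_mul_pow_ne_zero_of_qPoch_ne_zero h (show l + i < m by lia)
  rwa [hc, mul_assoc, ← pow_add]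

theorem qPoch_zpow_neg_eq_zero {q : ℂ} (hq : q ≠ 0) (m : ℕ) :
    qPoch q (q ^ (-(m : ℤ))) (m + 1) = 0 := by
  rw [qPoch_succ, zpow_neg, zpow_natCast, inv_mul_cancel₀ (pow_ne_zero _ hq), sub_self, mul_zero]

/-- The `j`-th term of the `q`-Dixon sum `Sdix`. -/
noncomputable def dixonTerm (q s b : ℂ) (n j : ℕ) : ℂ :=
  qPoch q (s ^ 2) j * qPoch q (-(q * s)) j * qPoch q b j * qPoch q (q ^ (-(n : ℤ))) j /
    (qPoch q q j * qPoch q (-s) j * qPoch q (s ^ 2 * q / b) j *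
      qPoch q (s ^ 2 * q ^ (n + 1)) j) * (q ^ (n + 1) * s / b) ^ j

theorem Sdix_eq_sum_dixonTerm (q s b : ℂ) (n : ℕ) :
    Sdix q s b n = ∑ j ∈ Finset.range (n + 1), dixonTerm q s b n j := rfl

theorem dixonTerm_zero (q s b : ℂ) (n : ℕ) : dixonTerm q s b n 0 = 1 := by
  simp [dixonTerm, qPoch]

theorem dixonTerm_succ_eq_zero {q : ℂ} (hq : q ≠ 0) (s b : ℂ) (n : ℕ) :
    dixonTerm q s b n (n + 1) = 0 := by
  rw [dixonTerm, qPoch_zpow_neg_eq_zero hq n, mul_zero, zero_div, zero_mul]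

/-- The recurrence for the `q`-Dixon sum holds term by term. -/
theorem dixonTerm_sub_dixonTerm {q s b : ℂ} {m i : ℕ} (hq : q ≠ 0) (hb : b ≠ 0) (hi : i ≤ m)
    (h1 : qPoch q q (m + 1) ≠ 0) (h2 : qPoch q (-s) (m + 2) ≠ 0)
    (h3 : qPoch q (s ^ 2 * q / b) (m + 2) ≠ 0) (h4 : qPoch q (s ^ 2 * q ^ m) (m + 3) ≠ 0) :
    dixonTerm q s b (m + 1) (i + 1) - dixonTerm q s b m (i + 1)
      = -((1 - s) * (1 + q * s) * (1 - s ^ 2 * q) * (1 - b) * (q ^ (m + 1) * s / b) /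
          ((1 - s ^ 2 * q / b) * (1 - s ^ 2 * q ^ (m + 1)) * (1 - s ^ 2 * q ^ (m + 1 + 1))))
          * dixonTerm q (s * q) (b * q) m i := by
  have hu : q ^ m ≠ 0 := pow_ne_zero _ hq
  have n1 : qPoch q q i ≠ 0 := qPoch_ne_zero_of_le h1 (by lia)
  have n1' : 1 - q * q ^ i ≠ 0 := one_sub_mul_pow_ne_zero_of_qPoch_ne_zero h1 (by lia)
  have n2 : qPoch q (-s * q) i ≠ 0 := qPoch_shift_ne_zero h2 (l := 1) (by ring) (by lia)
  have n2' : 1 + s ≠ 0 := by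
    simpa using one_sub_mul_pow_ne_zero_of_qPoch_ne_zero h2 (k := 0) (by lia)
  have n3 : qPoch q (s ^ 2 * q / b * q) i ≠ 0 :=
    qPoch_shift_ne_zero h3 (l := 1) (by ring) (by lia)
  have n3' : 1 - s ^ 2 * q / b ≠ 0 := by
    simpa using one_sub_mul_pow_ne_zero_of_qPoch_ne_zero h3 (k := 0) (by lia)
  have n4 : qPoch q (s ^ 2 * q ^ (m + 1 + 1) * q) i ≠ 0 :=
    qPoch_shift_ne_zero h4 (l := 3) (by ring) (by lia)
  have n4a : 1 - s ^ 2 * q ^ (m + 1) ≠ 0 := by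
    have := one_sub_mul_pow_ne_zero_of_qPoch_ne_zero h4 (k := 1) (by lia)
    rwa [mul_assoc, ← pow_add] at this
  have n4b : 1 - s ^ 2 * q ^ (m + 1 + 1) ≠ 0 := by
    have := one_sub_mul_pow_ne_zero_of_qPoch_ne_zero h4 (k := 2) (by lia)
    rwa [mul_assoc, ← pow_add] at this
  have n4c : 1 - s ^ 2 * q ^ (m + 1 + 1) * q ^ i ≠ 0 := by
    have := one_sub_mul_pow_ne_zero_of_qPoch_ne_zero h4 (k := 2 + i) (by lia)
    rwa [pow_add q 2 i, ← mul_assoc, mul_assoc (s ^ 2), ← pow_add] at this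
  have hA : qPoch q (s ^ 2 * q) i * (1 - s ^ 2 * q * q ^ i)
      = (1 - s ^ 2 * q) * qPoch q (s ^ 2 * q * q) i := by
    rw [← qPoch_succ, qPoch_succ_left]
  have hE : qPoch q (s ^ 2 * q ^ (m + 1 + 1)) i
      = (1 - s ^ 2 * q ^ (m + 1 + 1)) * qPoch q (s ^ 2 * q ^ (m + 1 + 1) * q) i /
        (1 - s ^ 2 * q ^ (m + 1 + 1) * q ^ i) := by
    rw [eq_div_iff n4c, ← qPoch_succ, qPoch_succ_left]
  have hz : q ^ (-((m + 1 : ℕ) : ℤ)) * q = q ^ (-(m : ℤ)) := by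
    rw [← zpow_add_one₀ hq]; congr 1; push_cast; ring
  have hz' : q ^ (-((m + 1 : ℕ) : ℤ)) = (q ^ m * q)⁻¹ := by
    rw [zpow_neg, zpow_natCast, pow_succ]
  have hz'' : q ^ (-(m : ℤ)) = (q ^ m)⁻¹ := by rw [zpow_neg, zpow_natCast]
  have e1 : (s * q) ^ 2 = s ^ 2 * q * q := by ring
  have e2 : -(q * (s * q)) = -(q * s) * q := by ring
  have e3 : -(s * q) = -s * q := by ring
  have e4 : s ^ 2 * q * q * q / (b * q) = s ^ 2 * q / b * q := by field_simp
  have e5 : s ^ 2 * q * q * q ^ (m + 1) = s ^ 2 * q ^ (m + 1 + 1) * q := by ring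
  have e6 : s ^ 2 * q ^ (m + 1) * q = s ^ 2 * q ^ (m + 1 + 1) := by ring
  have e7 : q ^ (m + 1) * (s * q) / (b * q) = q ^ (m + 1) * s / b := by field_simp
  have e8 : (q ^ (m + 1 + 1) * s / b) ^ (i + 1)
      = (q ^ (m + 1) * s / b) ^ i * q ^ i * (q ^ (m + 1 + 1) * s / b) := by
    rw [pow_succ, ← mul_pow]; ring
  unfold dixonTerm
  rw [e1, e2, e3, e4, e5, e7, e8, qPoch_succ_left q (s ^ 2), qPoch_succ_left q (-(q * s)),
    qPoch_succ_left q b, qPoch_succ_left q (q ^ (-((m + 1 : ℕ) : ℤ))), hz,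
    qPoch_succ q (q ^ (-(m : ℤ))), qPoch_succ q q, qPoch_succ_left q (-s),
    qPoch_succ_left q (s ^ 2 * q / b), qPoch_succ_left q (s ^ 2 * q ^ (m + 1 + 1)),
    qPoch_succ_left q (s ^ 2 * q ^ (m + 1)), e6, hE, pow_succ _ i, hz']
  generalize qPoch q (q ^ (-(m : ℤ))) i = Z
  rw [hz'']
  generalize qPoch q (s ^ 2 * q ^ (m + 1 + 1) * q) i = F at *
  generalize qPoch q (s ^ 2 * q / b * q) i = G at *
  generalize qPoch q (s ^ 2 * q) i = A at *
  generalize qPoch q (s ^ 2 * q * q) i = B at *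
  generalize qPoch q (-(q * s) * q) i = C at *
  generalize qPoch q (b * q) i = D at *
  generalize qPoch q (-s * q) i = H at *
  generalize qPoch q q i = I at *
  generalize (q ^ (m + 1) * s / b) ^ i = W at *
  have n2'' : 1 - -s ≠ 0 := by rwa [sub_neg_eq_add]
  calc _ = -(((1 - s) * (1 + q * s) * (1 - b) * (q ^ (m + 1) * s / b) /
          ((1 - s ^ 2 * q / b) * (1 - s ^ 2 * q ^ (m + 1)) * (1 - s ^ 2 * q ^ (m + 1 + 1)))) *
          (C * D * Z / (I * H * G * F) * W)) * (A * (1 - s ^ 2 * q * q ^ i)) := by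
        generalize 1 - s ^ 2 * q / b = K at *
        generalize hL : 1 - s ^ 2 * q ^ (m + 1) = L at *
        generalize hM : 1 - s ^ 2 * q ^ (m + 1 + 1) = M at *
        generalize hN : 1 - s ^ 2 * q ^ (m + 1 + 1) * q ^ i = N at *
        rw [pow_succ q (m + 1), pow_succ q m] at *
        generalize q ^ m = u at *
        generalize q ^ i = y at *
        field_simp
        rw [← hL, ← hN]
        ring
    _ = _ := by rw [hA]; ring

/-- Pfaff-type recurrence for the $q$-Dixon sum. -/
theorem dixon_recurrence (q : ℂ) (hq : q ≠ 0) (n : ℕ) (hn : 1 ≤ n) (s b : ℂ)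
    (hs : s ≠ 0) (hb : b ≠ 0)
    (h1 : qPoch q q n ≠ 0) (h2 : qPoch q (-s) (n + 1) ≠ 0)
    (h3 : qPoch q (s ^ 2 * q / b) (n + 1) ≠ 0)
    (h4 : qPoch q (s ^ 2 * q ^ ((n : ℤ) - 1)) (n + 2) ≠ 0)
    (h5 : b ≠ s ^ 2 * q) :
    Sdix q s b n - Sdix q s b (n - 1)
      = -((1 - s) * (1 + q * s) * (1 - s ^ 2 * q) * (1 - b) * (q ^ n * s / b) /
          ((1 - s ^ 2 * q / b) * (1 - s ^ 2 * q ^ n) * (1 - s ^ 2 * q ^ (n + 1))))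
          * Sdix q (s * q) (b * q) (n - 1) := by
  obtain ⟨m, rfl⟩ : ∃ m, n = m + 1 := ⟨n - 1, by lia⟩
  have h4' : qPoch q (s ^ 2 * q ^ m) (m + 3) ≠ 0 := by simpa using h4
  have hlast : Sdix q s b m = ∑ j ∈ Finset.range (m + 2), dixonTerm q s b m j := by
    rw [Finset.sum_range_succ, dixonTerm_succ_eq_zero hq, add_zero, Sdix_eq_sum_dixonTerm]
  rw [Nat.add_sub_cancel, hlast, Sdix_eq_sum_dixonTerm, Sdix_eq_sum_dixonTerm,
    ← Finset.sum_sub_distrib, Finset.sum_range_succ', dixonTerm_zero, dixonTerm_zero, sub_self,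
    add_zero, Finset.mul_sum]
  refine Finset.sum_congr rfl fun i hi => ?_
  exact dixonTerm_sub_dixonTerm hq hb (Nat.lt_succ_iff.mp (Finset.mem_range.mp hi)) h1 h2 h3 h4'
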